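/- Let d ≥ 1, n ∈ [2,3], c ∈ [1.55, n), μ < 0, and let Q be a solution of the IVP that is C³ on [0,τ) with Q(r) > 0 and Q_r(r) < 0 for all r ∈ (0,τ), where τ > 0. Then for every r ∈ (0,τ): Q_rr(r) + n Q_r(r)²/(2 Q(r)) + (d−1) Q_r(r)/r < F₃(Q(r), μ). -/

import Mathlib

open Set Filter Topology intervalIntegral Real

noncomputable section

/-- The rescaled traveling-wave ODE for the magma equation at a point `r`. -/
def magmaODE (d n c : ℝ) (Q : ℝ → ℝ) (r : ℝ) : Prop :=
  -deriv Q r + (1 / c) * deriv (fun s => Q s ^ n) r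
    + deriv (fun s => Q s ^ n * deriv (deriv Q) s) r
    + (d - 1) * Q r ^ n * deriv (fun s => deriv Q s / s) r = 0

/-- Solution of the IVP on `[0, σ]`. -/
def isIVPSolutionOn (d n c μ : ℝ) (Q : ℝ → ℝ) (σ : ℝ) : Prop :=
  ContDiffOn ℝ 3 Q (Icc 0 σ) ∧ (∀ r ∈ Ioo (0:ℝ) σ, magmaODE d n c Q r) ∧
    Q 0 = 1 ∧ deriv Q 0 = 0 ∧ deriv (deriv Q) 0 = μ

/-- Solution of the IVP on `[0, ∞)`. -/
def isIVPSolution (d n c μ : ℝ) (Q : ℝ → ℝ) : Prop :=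
  ContDiffOn ℝ 3 Q (Ici 0) ∧ (∀ r : ℝ, 0 < r → magmaODE d n c Q r) ∧
    Q 0 = 1 ∧ deriv Q 0 = 0 ∧ deriv (deriv Q) 0 = μ

def F1 (d n c : ℝ) (Q μ : ℝ) : ℝ :=
  -(1 / (n - 1)) * (Q ^ (1 - n) - 1) - (n / c) * Real.log Q + μ * d

def F2 (d n c : ℝ) (Q μ : ℝ) : ℝ :=
  ∫ q in (1:ℝ)..Q, F1 d n c q μ * q ^ n

def F3 (d n c : ℝ) (Q μ : ℝ) : ℝ :=
  F1 d n c Q μ - n * ∫ q in (1:ℝ)..Q, F2 d n c q μ * q ^ (-(n + 2))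

def mu1 (d n c Q : ℝ) : ℝ := -(F1 d n c Q 0) / (F1 d n c Q 1 - F1 d n c Q 0)
def mu2 (d n c Q : ℝ) : ℝ := -(F2 d n c Q 0) / (F2 d n c Q 1 - F2 d n c Q 0)
def mu3 (d n c Q : ℝ) : ℝ := -(F3 d n c Q 0) / (F3 d n c Q 1 - F3 d n c Q 0)

def h3ex (d n Q : ℝ) : ℝ :=
  d * (1 - n * Real.log Q / (n + 1) - n / (n + 1) ^ 2 * (Q ^ (-(n + 1)) - 1))

def setA (d n c Qs : ℝ) : Set ℝ :=
  {μ : ℝ | μ < 0 ∧ ∃ (Q : ℝ → ℝ) (σ rs : ℝ), 0 < rs ∧ rs < σ ∧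
    isIVPSolutionOn d n c μ Q σ ∧ (∀ r ∈ Ioc (0:ℝ) σ, 0 < Q r ∧ deriv Q r < 0) ∧
    Q rs = Qs}

/-- A function with positive derivative on `(0, τ)` that tends to `0` at `0⁺` is positive. -/
lemma pos_of_hasDerivAt_pos_of_tendsto_zero {f f' : ℝ → ℝ} {τ : ℝ}
    (hf : ∀ r ∈ Ioo (0:ℝ) τ, HasDerivAt f (f' r) r) (hf' : ∀ r ∈ Ioo (0:ℝ) τ, 0 < f' r)
    (hlim : Tendsto f (𝓝[>] 0) (𝓝 0)) : ∀ r ∈ Ioo (0:ℝ) τ, 0 < f r := by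
  have hmono : StrictMonoOn f (Ioo 0 τ) := by
    refine strictMonoOn_of_deriv_pos (convex_Ioo 0 τ)
      (fun r hr => (hf r hr).continuousAt.continuousWithinAt) fun r hr => ?_
    rw [interior_Ioo] at hr
    rw [(hf r hr).deriv]
    exact hf' r hr
  rintro r ⟨hr0, hrτ⟩
  have hmem : r / 2 ∈ Ioo 0 τ := ⟨by linarith, by linarith⟩
  have hhalf : 0 ≤ f (r / 2) := by
    refine le_of_tendsto hlim ?_
    filter_upwards [Ioo_mem_nhdsGT hmem.1] with s hs
    exact (hmono ⟨hs.1, hs.2.trans hmem.2⟩ hmem hs.2).le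
  exact hhalf.trans_lt (hmono hmem ⟨hr0, hrτ⟩ (by linarith))

lemma hasDerivAt_integral_of_continuousOn_Ioi {g : ℝ → ℝ} (hg : ContinuousOn g (Ioi 0)) {x : ℝ}
    (hx : 0 < x) : HasDerivAt (fun y => ∫ q in (1:ℝ)..y, g q) (g x) x := by
  have hsub : uIcc (1:ℝ) x ⊆ Ioi 0 := fun y hy => lt_of_lt_of_le (lt_min one_pos hx) hy.1
  exact integral_hasDerivAt_right ((hg.mono hsub).intervalIntegrable)
    (hg.stronglyMeasurableAtFilter isOpen_Ioi x hx) (hg.continuousAt (Ioi_mem_nhds hx))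

lemma hasDerivAt_F1 {d n c q μ : ℝ} (hn : n ≠ 1) (hq : 0 < q) :
    HasDerivAt (fun x => F1 d n c x μ) (q ^ (-n) - n / c / q) q := by
  have h := (((Real.hasDerivAt_rpow_const (p := 1 - n) (Or.inl hq.ne')).sub_const 1).const_mul
    (-(1 / (n - 1)))).sub ((Real.hasDerivAt_log hq.ne').const_mul (n / c)) |>.add_const (μ * d)
  refine h.congr_deriv ?_
  have hn' : n - 1 ≠ 0 := sub_ne_zero.mpr hn
  rw [show 1 - n - 1 = -n by ring]
  field_simp
  ring

lemma hasDerivAt_F2 {d n c q μ : ℝ} (hn : n ≠ 1) (hq : 0 < q) :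
    HasDerivAt (fun x => F2 d n c x μ) (F1 d n c q μ * q ^ n) q :=
  hasDerivAt_integral_of_continuousOn_Ioi (g := fun q => F1 d n c q μ * q ^ n)
    (fun x (hx : 0 < x) => ((hasDerivAt_F1 hn hx).continuousAt.mul
      (Real.continuousAt_rpow_const x n (Or.inl hx.ne'))).continuousWithinAt) hq

lemma hasDerivAt_F3 {d n c q μ : ℝ} (hn : n ≠ 1) (hq : 0 < q) :
    HasDerivAt (fun x => F3 d n c x μ)
      (q ^ (-n) - n / c / q - n * (F2 d n c q μ * q ^ (-(n + 2)))) q :=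
  (hasDerivAt_F1 hn hq).sub ((hasDerivAt_integral_of_continuousOn_Ioi
    (g := fun q => F2 d n c q μ * q ^ (-(n + 2)))
    (fun x (hx : 0 < x) => ((hasDerivAt_F2 hn hx).continuousAt.mul
      (Real.continuousAt_rpow_const x _ (Or.inl hx.ne'))).continuousWithinAt) hq).const_mul n)

lemma F1_one (d n c μ : ℝ) : F1 d n c 1 μ = μ * d := by simp [F1]

lemma F2_one (d n c μ : ℝ) : F2 d n c 1 μ = 0 := by simp [F2]

lemma F3_one (d n c μ : ℝ) : F3 d n c 1 μ = μ * d := by simp [F3, F1_one]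

/-- The second derivative of a `C²` function on `[0, τ)` has a limit at `0⁺`. -/
lemma exists_tendsto_deriv_deriv {Q : ℝ → ℝ} {τ : ℝ} (hτ : 0 < τ)
    (hreg : ContDiffOn ℝ 2 Q (Ico 0 τ)) :
    ∃ L, Tendsto (deriv (deriv Q)) (𝓝[>] 0) (𝓝 L) := by
  have hS : UniqueDiffOn ℝ (Ico 0 τ) := uniqueDiffOn_Ico 0 τ
  have h1 : ContDiffOn ℝ 1 (derivWithin Q (Ico 0 τ)) (Ico 0 τ) :=
    hreg.derivWithin hS (by norm_num)
  have h2 : ContDiffOn ℝ 0 (derivWithin (derivWithin Q (Ico 0 τ)) (Ico 0 τ)) (Ico 0 τ) :=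
    h1.derivWithin hS (by norm_num)
  have heq : ∀ f : ℝ → ℝ, ∀ r ∈ Ioo 0 τ, derivWithin f (Ico 0 τ) r = deriv f r :=
    fun f r hr => derivWithin_of_mem_nhds (Ico_mem_nhds hr.1 hr.2)
  have hlim := (h2.continuousOn 0 ⟨le_rfl, hτ⟩).tendsto.mono_left
    (nhdsWithin_mono 0 (Ioo_subset_Ico_self (a := (0:ℝ)) (b := τ)))
  rw [nhdsWithin_Ioo_eq_nhdsGT hτ] at hlim
  refine ⟨_, hlim.congr' ?_⟩
  filter_upwards [Ioo_mem_nhdsGT hτ] with r hr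
  rw [heq _ r hr]
  refine Filter.EventuallyEq.deriv_eq ?_
  filter_upwards [Ioo_mem_nhds hr.1 hr.2] with s hs using heq Q s hs

/-- The traveling-wave ODE solved for the derivative of the radial Laplacian. -/
lemma magmaODE.laplacian_deriv_eq {d n c r q1 q2 q3 : ℝ} {Q : ℝ → ℝ} (h : magmaODE d n c Q r)
    (hr : 0 < r) (hQ : 0 < Q r) (h0 : HasDerivAt Q q1 r) (h1 : HasDerivAt (deriv Q) q2 r)
    (h2 : HasDerivAt (deriv (deriv Q)) q3 r) :
    q3 + (d - 1) * ((q2 * r - q1) / r ^ 2) =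
      (Q r ^ (-n) - n / c / Q r) * q1 - n * q1 * q2 / Q r := by
  have hpow := h0.rpow_const (p := n) (Or.inl hQ.ne')
  have hdiv := h1.div (hasDerivAt_id r) hr.ne'
  have hmul := hpow.mul h2
  unfold magmaODE at h
  rw [hpow.deriv, show deriv (fun s => Q s ^ n * deriv (deriv Q) s) r = _ from hmul.deriv,
    show deriv (fun s => deriv Q s / s) r = _ from hdiv.deriv, h0.deriv, h1.deriv,
    Real.rpow_sub_one hQ.ne'] at h
  rw [Real.rpow_neg hQ.le]
  have hP : 0 < Q r ^ n := Real.rpow_pos_of_pos hQ n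
  simp only [id, mul_one] at h
  generalize Q r ^ n = P at h hP ⊢
  have hgoal : P * (q3 + (d - 1) * ((q2 * r - q1) / r ^ 2)
      - ((P⁻¹ - n / c / Q r) * q1 - n * q1 * q2 / Q r)) = 0 := by
    rw [← h]
    linear_combination -q1 * mul_inv_cancel₀ hP.ne'
  have := (mul_eq_zero.mp hgoal).resolve_left hP.ne'
  linarith

/-- The differential inequality (DE bound) in the paper. -/
theorem magma_DE_bound
    (d n c μ τ : ℝ) (hd : 1 ≤ d) (hn : n ∈ Icc (2:ℝ) 3) (hc : c ∈ Ico (1.55:ℝ) n)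
    (hμ : μ < 0) (hτ : 0 < τ) (Q : ℝ → ℝ)
    (hreg : ContDiffOn ℝ 3 Q (Ico 0 τ))
    (hode : ∀ r ∈ Ioo (0:ℝ) τ, magmaODE d n c Q r)
    (hQ0 : Q 0 = 1) (hQr0 : deriv Q 0 = 0) (hQrr0 : deriv (deriv Q) 0 = μ)
    (hpos : ∀ r ∈ Ioo (0:ℝ) τ, 0 < Q r) (hdec : ∀ r ∈ Ioo (0:ℝ) τ, deriv Q r < 0) :
    ∀ r ∈ Ioo (0:ℝ) τ,
      deriv (deriv Q) r + n * (deriv Q r) ^ 2 / (2 * Q r) + (d - 1) * deriv Q r / r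
        < F3 d n c (Q r) μ := by
  have hn1 : n ≠ 1 := by linarith [hn.1]
  have hn0 : 0 < n := by linarith [hn.1]
  have h3 : ∀ r ∈ Ioo (0:ℝ) τ, ContDiffAt ℝ 3 Q r := fun r hr =>
    hreg.contDiffAt (Ico_mem_nhds hr.1 hr.2)
  have hQd : ∀ r ∈ Ioo (0:ℝ) τ, HasDerivAt Q (deriv Q r) r := fun r hr =>
    ((h3 r hr).differentiableAt (by norm_num)).hasDerivAt
  have h2 : ∀ r ∈ Ioo (0:ℝ) τ, ContDiffAt ℝ 2 (deriv Q) r := fun r hr =>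
    (h3 r hr).derivWithin (by norm_num)
  have hQdd : ∀ r ∈ Ioo (0:ℝ) τ, HasDerivAt (deriv Q) (deriv (deriv Q) r) r := fun r hr =>
    ((h2 r hr).differentiableAt (by norm_num)).hasDerivAt
  have h1 : ∀ r ∈ Ioo (0:ℝ) τ, ContDiffAt ℝ 1 (deriv (deriv Q)) r := fun r hr =>
    (h2 r hr).derivWithin (by norm_num)
  have hQddd : ∀ r ∈ Ioo (0:ℝ) τ,
      HasDerivAt (deriv (deriv Q)) (deriv (deriv (deriv Q)) r) r := fun r hr =>
    ((h1 r hr).differentiableAt (by norm_num)).hasDerivAt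
  have hμd : HasDerivAt (deriv Q) μ 0 := by
    rw [← hQrr0]
    exact (differentiableAt_of_deriv_ne_zero (by rw [hQrr0]; exact hμ.ne)).hasDerivAt
  -- Limits at `0⁺`.
  have hQlim : Tendsto Q (𝓝[>] 0) (𝓝 1) := by
    have := (hreg.continuousOn 0 ⟨le_rfl, hτ⟩).tendsto.mono_left
      (nhdsWithin_mono 0 (Ioo_subset_Ico_self (a := (0:ℝ)) (b := τ)))
    rwa [nhdsWithin_Ioo_eq_nhdsGT hτ, hQ0] at this
  have hQrlim : Tendsto (deriv Q) (𝓝[>] 0) (𝓝 0) := by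
    have := hμd.continuousAt.tendsto.mono_left (nhdsWithin_le_nhds (s := Ioi 0))
    rwa [hQr0] at this
  have hslope : Tendsto (fun r => deriv Q r / r) (𝓝[>] 0) (𝓝 μ) := by
    have := (hasDerivWithinAt_iff_tendsto_slope' (self_notMem_Ioi)).1
      (hμd.hasDerivWithinAt (s := Ioi 0))
    refine this.congr fun r => ?_
    simp [slope_def_field, hQr0]
  have hQrrlim : Tendsto (deriv (deriv Q)) (𝓝[>] 0) (𝓝 μ) := by
    obtain ⟨L, hL⟩ := exists_tendsto_deriv_deriv hτ (hreg.of_le (by norm_num))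
    have hL' : HasDerivWithinAt (deriv Q) L (Ici 0) 0 :=
      hasDerivWithinAt_Ici_of_tendsto_deriv
        (fun r hr => (hQdd r hr).differentiableAt.differentiableWithinAt)
        hμd.continuousAt.continuousWithinAt (Ioo_mem_nhdsGT hτ) hL
    rwa [(uniqueDiffOn_Ici (0:ℝ) 0 self_mem_Ici).eq_deriv _ hL' hμd.hasDerivWithinAt] at hL
  set E : ℝ → ℝ := fun r =>
    deriv (deriv Q) r + n * (deriv Q r) ^ 2 / (2 * Q r) + (d - 1) * (deriv Q r / r) with hE
  have hElim : Tendsto E (𝓝[>] 0) (𝓝 (μ * d)) := by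
    have := (hQrrlim.add (((hQrlim.pow 2).const_mul n).div (hQlim.const_mul 2) (by norm_num))).add
      (hslope.const_mul (d - 1))
    rw [show μ + n * 0 ^ 2 / (2 * 1) + (d - 1) * μ = μ * d by ring] at this
    exact this
  have hEd : ∀ r ∈ Ioo (0:ℝ) τ, HasDerivAt E
      ((Q r ^ (-n) - n / c / Q r) * deriv Q r - n / 2 * deriv Q r ^ 3 / Q r ^ 2) r := by
    intro r hr
    have hQr := hpos r hr
    have hr0 : r ≠ 0 := hr.1.ne'
    have := ((hQddd r hr).add ((((hQdd r hr).pow 2).const_mul n).div ((hQd r hr).const_mul 2)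
      (by positivity))).add (((hQdd r hr).div (hasDerivAt_id r) hr0).const_mul (d - 1))
    refine this.congr_deriv ?_
    have key := (hode r hr).laplacian_deriv_eq hr.1 hQr (hQd r hr) (hQdd r hr) (hQddd r hr)
    have hQne := hQr.ne'
    have hquot : (n * ((2:ℕ) * deriv Q r ^ (2 - 1) * deriv (deriv Q) r) * (2 * Q r)
        - n * deriv Q r ^ 2 * (2 * deriv Q r)) / (2 * Q r) ^ 2
        = n * deriv Q r * deriv (deriv Q) r / Q r - n / 2 * deriv Q r ^ 3 / Q r ^ 2 := by
      field_simp
      push_cast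
      ring
    simp only [id, mul_one, Pi.pow_apply]
    linear_combination key + hquot
  have hGpos := pos_of_hasDerivAt_pos_of_tendsto_zero
    (f := fun r => E r - F1 d n c (Q r) μ)
    (fun r hr => (hEd r hr).sub ((hasDerivAt_F1 hn1 (hpos r hr)).comp r (hQd r hr)))
    (fun r hr => by
      have hQr := hpos r hr
      have hQ' := neg_pos.mpr (hdec r hr)
      have : 0 < n / 2 * (-deriv Q r) ^ 3 / Q r ^ 2 := by positivity
      linear_combination this)
    (by
      have := hElim.sub ((hasDerivAt_F1 (d := d) (c := c) (μ := μ) hn1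
        one_pos).continuousAt.tendsto.comp hQlim)
      rwa [F1_one, sub_self] at this)
  have hHpos := pos_of_hasDerivAt_pos_of_tendsto_zero
    (f := fun r => F2 d n c (Q r) μ - Q r ^ n * deriv Q r ^ 2 / 2)
    (f' := fun r => Q r ^ n * -deriv Q r * (E r - F1 d n c (Q r) μ - (d - 1) * (deriv Q r / r)))
    (fun r hr => by
      have hQr := hpos r hr
      have := ((hasDerivAt_F2 (d := d) (c := c) (μ := μ) hn1 hQr).comp r (hQd r hr)).sub
        ((((hQd r hr).rpow_const (p := n) (Or.inl hQr.ne')).mul ((hQdd r hr).pow 2)).div_const 2)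
      refine this.congr_deriv ?_
      rw [Real.rpow_sub_one hQr.ne']
      simp only [hE, Pi.pow_apply]
      field_simp
      push_cast
      ring)
    (fun r hr => by
      have hQ' := neg_pos.mpr (hdec r hr)
      have hP := Real.rpow_pos_of_pos (hpos r hr) n
      have hG := hGpos r hr
      have : 0 ≤ (d - 1) * (-deriv Q r / r) :=
        mul_nonneg (by linarith) (div_nonneg hQ'.le hr.1.le)
      rw [neg_div] at this
      refine mul_pos (mul_pos hP hQ') ?_
      linarith)
    (by
      have := ((hasDerivAt_F2 (d := d) (c := c) (μ := μ) hn1 one_pos).continuousAt.tendsto.comp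
        hQlim).sub (((hQlim.rpow_const (p := n) (Or.inl one_ne_zero)).mul (hQrlim.pow 2)).div_const 2)
      rw [F2_one, show (0:ℝ) - 1 ^ n * 0 ^ 2 / 2 = 0 by ring] at this
      exact this)
  have hKpos := pos_of_hasDerivAt_pos_of_tendsto_zero
    (f := fun r => F3 d n c (Q r) μ - E r)
    (f' := fun r => n * -deriv Q r * Q r ^ (-(n + 2)) *
      (F2 d n c (Q r) μ - Q r ^ n * deriv Q r ^ 2 / 2))
    (fun r hr => by
      have hQr := hpos r hr
      refine (((hasDerivAt_F3 hn1 hQr).comp r (hQd r hr)).sub (hEd r hr)).congr_deriv ?_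
      have hinv : Q r ^ (-(n + 2)) * Q r ^ n = 1 / Q r ^ 2 := by
        rw [← Real.rpow_add hQr, show -(n + 2) + n = -(2:ℕ) by push_cast; ring,
          Real.rpow_neg hQr.le, Real.rpow_natCast, one_div]
      linear_combination -n / 2 * deriv Q r ^ 3 * hinv)
    (fun r hr => mul_pos (mul_pos (mul_pos hn0 (neg_pos.mpr (hdec r hr)))
      (Real.rpow_pos_of_pos (hpos r hr) _)) (hHpos r hr))
    (by
      have := ((hasDerivAt_F3 (d := d) (c := c) (μ := μ) hn1 one_pos).continuousAt.tendsto.comp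
        hQlim).sub hElim
      rwa [F3_one, sub_self] at this)
  intro r hr
  have := hKpos r hr
  simp only [hE] at this
  rw [mul_div_assoc (d - 1)]
  linarith
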